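/- Let ℙ be a multiplicative subsemigroup of the positive integers. Every ℙ-torsion-free cone admits a strongly unitary embedding into a ℙ-torsion-free refinement cone. -/

import Mathlib

universe u

/-- Conical commutative monoid ("cone"): `x + y = 0` implies `x = y = 0`. -/
def IsConical (M : Type u) [AddCommMonoid M] : Prop :=
  ∀ x y : M, x + y = 0 → x = 0 ∧ y = 0

/-- Algebraic preorder: `x ≤ y` iff `∃ z, x + z = y`. -/
def AlgLE {M : Type u} [AddCommMonoid M] (x y : M) : Prop :=
  ∃ z : M, x + z = y

/-- Refinement monoid. -/
def IsRefinementMonoid (M : Type u) [AddCommMonoid M] : Prop :=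
  ∀ a₀ a₁ b₀ b₁ : M, a₀ + a₁ = b₀ + b₁ →
    ∃ c₀₀ c₀₁ c₁₀ c₁₁ : M,
      a₀ = c₀₀ + c₀₁ ∧ a₁ = c₁₀ + c₁₁ ∧ b₀ = c₀₀ + c₁₀ ∧ b₁ = c₀₁ + c₁₁

/-- Unitary homomorphism: injective, cofinal image, and `f a₀ + b = f a₁ → b ∈ range f`. -/
def IsUnitary {A : Type u} {B : Type u} [AddCommMonoid A] [AddCommMonoid B]
    (f : A →+ B) : Prop :=
  Function.Injective f ∧
  (∀ b : B, ∃ a : A, AlgLE b (f a)) ∧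
  (∀ a₀ a₁ : A, ∀ b : B, f a₀ + b = f a₁ → b ∈ Set.range f)

/-- Strongly unitary homomorphism. -/
def IsStronglyUnitary {A : Type u} {B : Type u} [AddCommMonoid A] [AddCommMonoid B]
    (f : A →+ B) : Prop :=
  IsUnitary f ∧ ∀ m : ℕ, 0 < m → ∀ b : B, m • b ∈ Set.range f → b ∈ Set.range f

/-- Normally divisible commutative monoid. -/
def IsNormallyDivisible (M : Type u) [AddCommMonoid M] : Prop :=
  ∀ p : ℕ, 0 < p → ∀ X : Finset M, ∀ a : M,
    ∃ u : M, p • u = a ∧ ∀ x ∈ X, ∀ y ∈ X, x + a = y + a → x + u = y + u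

/-- Order-embedding of commutative monoids (w.r.t. the algebraic preorders). -/
def IsOrderEmbeddingHom {A : Type u} {B : Type u} [AddCommMonoid A] [AddCommMonoid B]
    (f : A →+ B) : Prop :=
  Function.Injective f ∧ ∀ x y : A, AlgLE x y ↔ AlgLE (f x) (f y)

/-- Simple commutative monoid: every `u ≰ 0` is an order-unit. -/
def IsSimpleMonoid (M : Type u) [AddCommMonoid M] : Prop :=
  ∀ u : M, ¬ AlgLE u 0 → ∀ x : M, ∃ n : ℕ, 0 < n ∧ AlgLE x (n • u)

/-- Weak sum decomposition axiom (WSD). -/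
def WSD (M : Type u) [AddCommMonoid M] : Prop :=
  ∀ a₀ a₁ b c : M, a₀ + a₁ + c = b + c →
    ∃ x₀ x₁ : M, a₀ + c = x₀ + c ∧ a₁ + c = x₁ + c ∧ b = x₀ + x₁

/-- `a ∝ b` : `a ≤ n • b` for some positive integer `n`. -/
def Propto {M : Type u} [AddCommMonoid M] (a b : M) : Prop :=
  ∃ n : ℕ, 0 < n ∧ AlgLE a (n • b)

/-- `a ≍ b` : `a ∝ b` and `b ∝ a`. -/
def Asymp {M : Type u} [AddCommMonoid M] (a b : M) : Prop :=
  Propto a b ∧ Propto b a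

/-- Cancellative commutative monoid. -/
def IsCancellativeMonoid (M : Type u) [AddCommMonoid M] : Prop :=
  ∀ x y z : M, x + z = y + z → x = y

/-- Separative commutative monoid. -/
def IsSeparative (M : Type u) [AddCommMonoid M] : Prop :=
  ∀ x y : M, 2 • x = x + y → x + y = 2 • y → x = y

/-- Stably finite commutative monoid. -/
def IsStablyFinite (M : Type u) [AddCommMonoid M] : Prop :=
  ∀ x y : M, x + y = y → x = 0

/-- Quasi-divisible commutative monoid. -/
def IsQuasiDivisible (M : Type u) [AddCommMonoid M] : Prop :=
  ∀ x : M, ∃ u v : M, 2 • u + 3 • v = x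

/-- `ℙ`-torsion-free commutative monoid. -/
def PTorsionFree (P : Set ℕ) (M : Type u) [AddCommMonoid M] : Prop :=
  ∀ p ∈ P, ∀ x y : M, p • x = p • y → x = y

/-- `ℙ`-unperforated commutative monoid (w.r.t. the algebraic preorder). -/
def PUnperforated (P : Set ℕ) (M : Type u) [AddCommMonoid M] : Prop :=
  ∀ p ∈ P, ∀ x y : M, AlgLE (p • x) (p • y) → AlgLE x y

namespace IsStronglyUnitary

variable {A B C : Type u} [AddCommMonoid A] [AddCommMonoid B] [AddCommMonoid C]

theorem injective {f : A →+ B} (hf : IsStronglyUnitary f) : Function.Injective f := hf.1.1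

theorem id : IsStronglyUnitary (AddMonoidHom.id A) :=
  ⟨⟨Function.injective_id, fun b => ⟨b, 0, add_zero b⟩, fun _ _ b _ => ⟨b, rfl⟩⟩,
    fun _ _ b _ => ⟨b, rfl⟩⟩

theorem comp {g : B →+ C} {f : A →+ B} (hg : IsStronglyUnitary g) (hf : IsStronglyUnitary f) :
    IsStronglyUnitary (g.comp f) := by
  refine ⟨⟨hg.injective.comp hf.injective, fun c => ?_, fun a₀ a₁ c h => ?_⟩, fun m hm c h => ?_⟩
  · obtain ⟨b, z, hz⟩ := hg.1.2.1 c
    obtain ⟨a, w, hw⟩ := hf.1.2.1 b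
    exact ⟨a, z + g w, by rw [← add_assoc, hz, ← map_add, hw]; rfl⟩
  · obtain ⟨b, rfl⟩ := hg.1.2.2 _ _ _ h
    obtain ⟨a, rfl⟩ := hf.1.2.2 a₀ a₁ b (hg.injective (by simpa using h))
    exact ⟨a, rfl⟩
  · obtain ⟨a, ha⟩ := h
    obtain ⟨b, rfl⟩ := hg.2 m hm c ⟨f a, ha⟩
    obtain ⟨a', rfl⟩ := hf.2 m hm b ⟨a, hg.injective (by simpa using ha)⟩
    exact ⟨a', rfl⟩

end IsStronglyUnitary

section SyntacticCongruence

variable {C M G : Type u} [AddCommMonoid C] [AddCommMonoid M] [AddCommGroup G]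

/-- The syntactic congruence of a partial evaluation: `val` is only meaningful on elements of
degree zero, and two elements are identified if they have the same degree and every translate
of degree zero gives them the same value. -/
def syntacticAddCon (deg : C →+ G) (val : C → M) : AddCon C where
  r x y := deg x = deg y ∧ ∀ z, deg (x + z) = 0 → val (x + z) = val (y + z)
  iseqv :=
    { refl := fun _ => ⟨rfl, fun _ _ => rfl⟩
      symm := fun {x y} h => ⟨h.1.symm, fun z hz =>
        (h.2 z (by rw [map_add, h.1, ← map_add, hz])).symm⟩
      trans := fun {x y w} h h' => ⟨h.1.trans h'.1, fun z hz =>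
        (h.2 z hz).trans (h'.2 z (by rw [map_add, ← h.1, ← map_add, hz]))⟩ }
  add' := fun {w x y z} h h' => by
    refine ⟨by rw [map_add, map_add, h.1, h'.1], fun t ht => ?_⟩
    have e₁ := h.2 (y + t) (by rw [← add_assoc, ht])
    have e₂ := h'.2 (x + t) (by
      rw [← ht]; simp only [map_add, h.1]; abel)
    calc val (w + y + t) = val (w + (y + t)) := by rw [add_assoc]
      _ = val (x + (y + t)) := e₁
      _ = val (y + (x + t)) := by rw [add_left_comm]
      _ = val (z + (x + t)) := e₂
      _ = val (x + z + t) := by rw [add_left_comm, add_assoc]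

theorem syntacticAddCon.val_eq {deg : C →+ G} {val : C → M} {x y : C} (hx : deg x = 0)
    (e : (x : (syntacticAddCon deg val).Quotient) = y) : val x = val y := by
  simpa using ((AddCon.eq _).1 e).2 0 (by simpa using hx)

/-- A graded monoid together with an evaluation of its degree zero part in `M`. -/
structure IsGradedEvaluation (deg : C →+ G) (val : C → M) (ι : M →+ C) : Prop where
  deg_ι : ∀ m, deg (ι m) = 0
  val_ι : ∀ m, val (ι m) = m
  val_add : ∀ x y, deg x = 0 → deg y = 0 → val (x + y) = val x + val y
  complement : ∀ x, ∃ y, deg (x + y) = 0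

namespace IsGradedEvaluation

variable {deg : C →+ G} {val : C → M} {ι : M →+ C}

theorem mk_eq (h : IsGradedEvaluation deg val ι) {x : C} (hx : deg x = 0) :
    (x : (syntacticAddCon deg val).Quotient) = ι (val x) := by
  refine (AddCon.eq _).2 ⟨by rw [hx, h.deg_ι], fun z hz => ?_⟩
  have hz' : deg z = 0 := by simpa [hx] using hz
  rw [h.val_add _ _ hx hz', h.val_add _ _ (h.deg_ι _) hz', h.val_ι]

theorem val_zero (h : IsGradedEvaluation deg val ι) : val 0 = 0 := by
  simpa using h.val_ι 0

theorem val_nsmul (h : IsGradedEvaluation deg val ι) {x : C} (hx : deg x = 0) (n : ℕ) :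
    val (n • x) = n • val x := by
  induction n with
  | zero => simpa using h.val_zero
  | succ n ih => rw [succ_nsmul, h.val_add _ _ (by simp [hx]) hx, ih, succ_nsmul]

theorem isConical (h : IsGradedEvaluation deg val ι) (hC : IsConical C)
    (h₀ : ∀ x, deg x = 0 → val x = 0 → x = 0) :
    IsConical (syntacticAddCon deg val).Quotient := by
  intro x y
  induction x using AddCon.induction_on with | _ x
  induction y using AddCon.induction_on with | _ y
  intro e
  have e' : ((x + y : C) : (syntacticAddCon deg val).Quotient) = (0 : C) := e
  have hd : deg (x + y) = 0 := by simpa using ((AddCon.eq _).1 e').1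
  obtain ⟨rfl, rfl⟩ := hC x y (h₀ _ hd ((syntacticAddCon.val_eq hd e').trans h.val_zero))
  exact ⟨rfl, rfl⟩

theorem pTorsionFree [IsAddTorsionFree G] (h : IsGradedEvaluation deg val ι) {P : Set ℕ}
    (hP : ∀ p ∈ P, 0 < p) (hM : PTorsionFree P M) :
    PTorsionFree P (syntacticAddCon deg val).Quotient := by
  intro p hp x y
  induction x using AddCon.induction_on with | _ x
  induction y using AddCon.induction_on with | _ y
  intro e
  have e' : ((p • x : C) : (syntacticAddCon deg val).Quotient) = (p • y : C) := e
  have hd : deg x = deg y :=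
    nsmul_right_injective (hP p hp).ne' (by simpa using ((AddCon.eq _).1 e').1)
  refine (AddCon.eq _).2 ⟨hd, fun z hz => hM p hp _ _ ?_⟩
  have hz' : deg (y + z) = 0 := by rw [map_add, ← hd, ← map_add, hz]
  rw [← h.val_nsmul hz, ← h.val_nsmul hz', nsmul_add, nsmul_add]
  exact ((AddCon.eq _).1 e').2 _ (by rw [← nsmul_add, map_nsmul, hz, nsmul_zero])

theorem isStronglyUnitary [IsAddTorsionFree G] (h : IsGradedEvaluation deg val ι) :
    IsStronglyUnitary ((syntacticAddCon deg val).mk'.comp ι) := by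
  have range : ∀ x : C, deg x = 0 → (x : (syntacticAddCon deg val).Quotient) ∈
      Set.range ((syntacticAddCon deg val).mk'.comp ι) := fun x hx =>
    ⟨val x, (h.mk_eq hx).symm⟩
  refine ⟨⟨fun a b e => ?_, fun b => ?_, fun a₀ a₁ b => ?_⟩, fun m hm b => ?_⟩
  · simpa [h.val_ι] using syntacticAddCon.val_eq (h.deg_ι a) e
  · induction b using AddCon.induction_on with | _ b
    obtain ⟨y, hy⟩ := h.complement b
    exact ⟨val (b + y), (y : (syntacticAddCon deg val).Quotient), h.mk_eq hy⟩
  · induction b using AddCon.induction_on with | _ b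
    intro e
    have e' : ((ι a₀ + b : C) : (syntacticAddCon deg val).Quotient) = ι a₁ := e
    exact range b (by simpa [h.deg_ι] using ((AddCon.eq _).1 e').1)
  · induction b using AddCon.induction_on with | _ b
    rintro ⟨a, e⟩
    have e' : (ι a : (syntacticAddCon deg val).Quotient) = (m • b : C) := e
    have hd : m • deg b = 0 := by simpa [h.deg_ι] using ((AddCon.eq _).1 e').1.symm
    exact range b (nsmul_right_injective hm.ne' (by simpa using hd))

end IsGradedEvaluation

end SyntacticCongruence

section Cell

variable {M : Type u} [AddCommMonoid M]

/-- The degree of a `2 × 2` matrix `(p, q, r, s)` of natural numbers; it vanishes exactly when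
the matrix is a sum of rows and columns. -/
def cellDeg : (ℕ × ℕ × ℕ × ℕ) →+ ℤ where
  toFun x := x.1 + x.2.2.2 - x.2.1 - x.2.2.1
  map_zero' := by simp
  map_add' x y := by simp; ring

/-- The value of a matrix of degree zero when its rows are sent to `a₀`, `a₁` and its columns
to `b₀`, `b₁`. -/
def cellVal (a₀ a₁ b₀ b₁ : M) (x : ℕ × ℕ × ℕ × ℕ) : M :=
  min x.1 x.2.1 • a₀ + (x.2.2.1 - (x.1 - x.2.1)) • a₁ + (x.1 - x.2.1) • b₀ + (x.2.1 - x.1) • b₁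

variable {a₀ a₁ b₀ b₁ : M}

theorem cellVal_eq (e : a₀ + a₁ = b₀ + b₁) (i j k l : ℕ) :
    cellVal a₀ a₁ b₀ b₁ (i + k, i + l, j + k, j + l) = i • a₀ + j • a₁ + k • b₀ + l • b₁ := by
  unfold cellVal
  rcases le_total k l with h | h
  · obtain ⟨t, rfl⟩ := Nat.exists_eq_add_of_le h
    have h₁ : min (i + k) (i + (k + t)) = i + k := by omega
    have h₂ : i + k - (i + (k + t)) = 0 := by omega
    have h₃ : i + (k + t) - (i + k) = t := by omega
    simp only [h₁, h₂, h₃, Nat.sub_zero, zero_nsmul, add_nsmul]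
    calc _ = i • a₀ + j • a₁ + t • b₁ + k • (a₀ + a₁) := by rw [nsmul_add]; abel
      _ = _ := by rw [e, nsmul_add]; abel
  · obtain ⟨t, rfl⟩ := Nat.exists_eq_add_of_le h
    have h₁ : min (i + (l + t)) (i + l) = i + l := by omega
    have h₂ : i + (l + t) - (i + l) = t := by omega
    have h₃ : i + l - (i + (l + t)) = 0 := by omega
    have h₄ : j + (l + t) - t = j + l := by omega
    simp only [h₁, h₂, h₃, h₄, zero_nsmul, add_nsmul]
    calc _ = i • a₀ + j • a₁ + t • b₀ + l • (a₀ + a₁) := by rw [nsmul_add]; abel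
      _ = _ := by rw [e, nsmul_add]; abel

theorem exists_of_cellDeg_eq_zero {x : ℕ × ℕ × ℕ × ℕ} (hx : cellDeg x = 0) :
    ∃ i j k l : ℕ, x = (i + k, i + l, j + k, j + l) := by
  obtain ⟨p, q, r, s⟩ := x
  have hx' : (p : ℤ) + s - q - r = 0 := hx
  refine ⟨min p q, r - (p - q), p - q, q - p, ?_⟩
  simp only [Prod.mk.injEq]
  omega

theorem cellVal_add (e : a₀ + a₁ = b₀ + b₁) {x y : ℕ × ℕ × ℕ × ℕ} (hx : cellDeg x = 0)
    (hy : cellDeg y = 0) :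
    cellVal a₀ a₁ b₀ b₁ (x + y) = cellVal a₀ a₁ b₀ b₁ x + cellVal a₀ a₁ b₀ b₁ y := by
  obtain ⟨i, j, k, l, rfl⟩ := exists_of_cellDeg_eq_zero hx
  obtain ⟨i', j', k', l', rfl⟩ := exists_of_cellDeg_eq_zero hy
  have : ((i + k, i + l, j + k, j + l) + (i' + k', i' + l', j' + k', j' + l') : ℕ × ℕ × ℕ × ℕ) =
      ((i + i') + (k + k'), (i + i') + (l + l'), (j + j') + (k + k'), (j + j') + (l + l')) := by
    simp only [Prod.mk_add_mk, Prod.mk.injEq]; omega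
  rw [this, cellVal_eq e, cellVal_eq e, cellVal_eq e]
  simp only [add_nsmul]
  abel

theorem cellVal_zero : cellVal a₀ a₁ b₀ b₁ 0 = 0 := by simp [cellVal]

theorem IsConical.eq_zero_of_nsmul (hM : IsConical M) {n : ℕ} {a : M} (ha : a ≠ 0)
    (h : n • a = 0) : n = 0 := by
  cases n with
  | zero => rfl
  | succ n => exact absurd (hM _ _ ((succ_nsmul a n).symm.trans h)).2 ha

theorem IsConical.sum_eq_zero (hM : IsConical M) {α : Type*} {s : Finset α} {g : α → M}
    (h : ∑ i ∈ s, g i = 0) : ∀ i ∈ s, g i = 0 := by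
  classical
  intro i hi
  rw [← Finset.add_sum_erase s g hi] at h
  exact (hM _ _ h).1

theorem cellVal_eq_zero (hM : IsConical M) (e : a₀ + a₁ = b₀ + b₁) (h₁ : a₀ ≠ 0) (h₂ : a₁ ≠ 0)
    (h₃ : b₀ ≠ 0) (h₄ : b₁ ≠ 0) {x : ℕ × ℕ × ℕ × ℕ} (hx : cellDeg x = 0)
    (h : cellVal a₀ a₁ b₀ b₁ x = 0) : x = 0 := by
  obtain ⟨i, j, k, l, rfl⟩ := exists_of_cellDeg_eq_zero hx
  rw [cellVal_eq e] at h
  obtain ⟨h, hl⟩ := hM _ _ h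
  obtain ⟨h, hk⟩ := hM _ _ h
  obtain ⟨hi, hj⟩ := hM _ _ h
  rw [hM.eq_zero_of_nsmul h₁ hi, hM.eq_zero_of_nsmul h₂ hj, hM.eq_zero_of_nsmul h₃ hk,
    hM.eq_zero_of_nsmul h₄ hl]
  rfl

end Cell

section OneStep

variable (M : Type u) [AddCommMonoid M]

/-- The nondegenerate refinement problems in `M`. -/
structure RefinementProblem where
  (a₀ a₁ b₀ b₁ : M)
  eq : a₀ + a₁ = b₀ + b₁
  a₀_ne : a₀ ≠ 0
  a₁_ne : a₁ ≠ 0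
  b₀_ne : b₀ ≠ 0
  b₁_ne : b₁ ≠ 0

variable {M}

/-- The value of a matrix of degree zero for the given refinement problem. -/
def RefinementProblem.val (e : RefinementProblem M) : ℕ × ℕ × ℕ × ℕ → M :=
  cellVal e.a₀ e.a₁ e.b₀ e.b₁

variable (M) in
/-- `M` with four free generators adjoined for each refinement problem. -/
abbrev CellExtension : Type u := M × (RefinementProblem M →₀ ℕ × ℕ × ℕ × ℕ)

namespace CellExtension

variable (M) in
/-- The degree, recording `cellDeg` for each refinement problem. -/
noncomputable def deg : CellExtension M →+ (RefinementProblem M →₀ ℤ) :=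
  (Finsupp.mapRange.addMonoidHom cellDeg).comp (AddMonoidHom.snd M _)

/-- The value in `M` of an element of degree zero. -/
noncomputable def val (x : CellExtension M) : M :=
  x.1 + x.2.sum fun e c => e.val c

theorem deg_eq_zero_iff {x : CellExtension M} : deg M x = 0 ↔ ∀ e, cellDeg (x.2 e) = 0 :=
  DFunLike.ext_iff

theorem isGradedEvaluation :
    IsGradedEvaluation (deg M) (val (M := M)) (AddMonoidHom.inl M _) where
  deg_ι m := by simp [deg]
  val_ι m := by simp [val]
  val_add x y hx hy := by
    classical
    rw [deg_eq_zero_iff] at hx hy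
    have val_zero {e : RefinementProblem M} : e.val 0 = 0 := cellVal_zero
    have key : (x.2 + y.2).sum (fun e c => e.val c) =
        x.2.sum (fun e c => e.val c) + y.2.sum (fun e c => e.val c) := by
      rw [Finsupp.sum_of_support_subset _ Finsupp.support_add _ fun _ _ => val_zero,
        Finsupp.sum_of_support_subset x.2 (Finset.subset_union_left (s₂ := y.2.support)) _
          fun _ _ => val_zero,
        Finsupp.sum_of_support_subset y.2 (Finset.subset_union_right (s₁ := x.2.support)) _
          fun _ _ => val_zero, ← Finset.sum_add_distrib]
      exact Finset.sum_congr rfl fun e _ => cellVal_add e.eq (hx e) (hy e)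
    simp only [val, Prod.fst_add, Prod.snd_add, key]
    abel
  complement x := by
    refine ⟨(0, x.2.mapRange (fun c => (c.2.1, c.1, c.2.2.2, c.2.2.1)) rfl), ?_⟩
    rw [deg_eq_zero_iff]
    intro e
    simp [cellDeg]
    ring

theorem isConical (hM : IsConical M) : IsConical (CellExtension M) := by
  intro x y h
  obtain ⟨h₁, h₂⟩ := Prod.ext_iff.1 h
  obtain ⟨hx, hy⟩ := hM _ _ h₁
  have h₃ : ∀ e, x.2 e = 0 ∧ y.2 e = 0 := fun e => by
    simpa [Prod.ext_iff, and_assoc, and_left_comm] using DFunLike.congr_fun h₂ e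
  exact ⟨Prod.ext hx (Finsupp.ext fun e => (h₃ e).1), Prod.ext hy (Finsupp.ext fun e => (h₃ e).2)⟩

theorem eq_zero_of_val (hM : IsConical M) (x : CellExtension M) (hd : deg M x = 0)
    (hv : val x = 0) : x = 0 := by
  obtain ⟨h₁, h₂⟩ := hM _ _ hv
  rw [deg_eq_zero_iff] at hd
  refine Prod.ext h₁ (Finsupp.ext fun e => ?_)
  by_contra hne
  exact hne (cellVal_eq_zero hM e.eq e.a₀_ne e.a₁_ne e.b₀_ne e.b₁_ne (hd e)
    (hM.sum_eq_zero h₂ e (Finsupp.mem_support_iff.2 hne)))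

end CellExtension

open CellExtension in
theorem exists_stronglyUnitary_refining {P : Set ℕ} (hP : ∀ p ∈ P, 0 < p) (hM : IsConical M)
    (hMtf : PTorsionFree P M) :
    ∃ (N : Type u) (_ : AddCommMonoid N) (f : M →+ N),
      IsConical N ∧ PTorsionFree P N ∧ IsStronglyUnitary f ∧
      ∀ a₀ a₁ b₀ b₁ : M, a₀ + a₁ = b₀ + b₁ → ∃ c₀₀ c₀₁ c₁₀ c₁₁ : N,
        f a₀ = c₀₀ + c₀₁ ∧ f a₁ = c₁₀ + c₁₁ ∧ f b₀ = c₀₀ + c₁₀ ∧ f b₁ = c₀₁ + c₁₁ := by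
  have H := isGradedEvaluation (M := M)
  refine ⟨_, _, (syntacticAddCon (deg M) val).mk'.comp (AddMonoidHom.inl M _),
    H.isConical (CellExtension.isConical hM) (eq_zero_of_val hM), H.pTorsionFree hP hMtf,
    H.isStronglyUnitary, fun a₀ a₁ b₀ b₁ e => ?_⟩
  set f := (syntacticAddCon (deg M) val).mk'.comp (AddMonoidHom.inl M _)
  rcases eq_or_ne a₀ 0 with rfl | h₁
  · exact ⟨0, 0, f b₀, f b₁, by simp, by rw [← map_add, ← e, zero_add], by simp, by simp⟩
  rcases eq_or_ne a₁ 0 with rfl | h₂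
  · exact ⟨f b₀, f b₁, 0, 0, by rw [← map_add, ← e, add_zero], by simp, by simp, by simp⟩
  rcases eq_or_ne b₀ 0 with rfl | h₃
  · exact ⟨0, f a₀, 0, f a₁, by simp, by simp, by simp, by rw [← map_add, e, zero_add]⟩
  rcases eq_or_ne b₁ 0 with rfl | h₄
  · exact ⟨f a₀, 0, f a₁, 0, by simp, by simp, by rw [← map_add, e, add_zero], by simp⟩
  let E : RefinementProblem M := ⟨a₀, a₁, b₀, b₁, e, h₁, h₂, h₃, h₄⟩
  let c (x : ℕ × ℕ × ℕ × ℕ) : CellExtension M := (0, Finsupp.single E x)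
  have c_add (x y) : c x + c y = c (x + y) := by simp [c]
  have f_eq (i j k l : ℕ) : f (i • a₀ + j • a₁ + k • b₀ + l • b₁) =
      (c (i + k, i + l, j + k, j + l) : (syntacticAddCon (deg M) val).Quotient) := by
    have hd : deg M (c (i + k, i + l, j + k, j + l)) = 0 := by
      have hc : cellDeg (i + k, i + l, j + k, j + l) = 0 := by
        simp [cellDeg]
        ring
      simp [deg, c, hc]
    have hv : val (c (i + k, i + l, j + k, j + l)) = i • a₀ + j • a₁ + k • b₀ + l • b₁ := by
      have h0 : E.val 0 = 0 := cellVal_zero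
      rw [← cellVal_eq e]
      simp [val, c, Finsupp.sum_single_index h0]
      rfl
    rw [H.mk_eq hd, hv]
    rfl
  refine ⟨(c (1, 0, 0, 0) : CellExtension M), (c (0, 1, 0, 0) : CellExtension M),
    (c (0, 0, 1, 0) : CellExtension M), (c (0, 0, 0, 1) : CellExtension M), ?_, ?_, ?_, ?_⟩ <;>
    rw [← AddCon.coe_add, c_add]
  · simpa using f_eq 1 0 0 0
  · simpa using f_eq 0 1 0 0
  · simpa using f_eq 0 0 1 0
  · simpa using f_eq 0 0 0 1

end OneStep

section Limit

open CategoryTheory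

theorem exists_refining_functor {P : Set ℕ} (hP : ∀ p ∈ P, 0 < p) (M : Type u) [AddCommMonoid M]
    (hM : IsConical M) (hMtf : PTorsionFree P M) :
    ∃ F : ℕ ⥤ AddCommMonCat.{u}, F.obj 0 = AddCommMonCat.of M ∧
      (∀ i, IsConical (F.obj i)) ∧ (∀ i, PTorsionFree P (F.obj i)) ∧
      (∀ i j (h : i ≤ j), IsStronglyUnitary (F.map (homOfLE h)).hom) ∧
      ∀ i, ∀ a₀ a₁ b₀ b₁ : F.obj i, a₀ + a₁ = b₀ + b₁ → ∃ c₀₀ c₀₁ c₁₀ c₁₁ : F.obj (i + 1),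
        (F.map (homOfLE i.le_succ)).hom a₀ = c₀₀ + c₀₁ ∧
        (F.map (homOfLE i.le_succ)).hom a₁ = c₁₀ + c₁₁ ∧
        (F.map (homOfLE i.le_succ)).hom b₀ = c₀₀ + c₁₀ ∧
        (F.map (homOfLE i.le_succ)).hom b₁ = c₀₁ + c₁₁ := by
  have step (X : {X : AddCommMonCat.{u} // IsConical X ∧ PTorsionFree P X}) :
      ∃ (Y : {X : AddCommMonCat.{u} // IsConical X ∧ PTorsionFree P X}) (f : X.1 ⟶ Y.1),
        IsStronglyUnitary f.hom ∧
        ∀ a₀ a₁ b₀ b₁ : X.1, a₀ + a₁ = b₀ + b₁ → ∃ c₀₀ c₀₁ c₁₀ c₁₁ : Y.1,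
          f.hom a₀ = c₀₀ + c₀₁ ∧ f.hom a₁ = c₁₀ + c₁₁ ∧
          f.hom b₀ = c₀₀ + c₁₀ ∧ f.hom b₁ = c₀₁ + c₁₁ := by
    obtain ⟨N, _, f, hN, hNtf, hf, hr⟩ := exists_stronglyUnitary_refining hP X.2.1 X.2.2
    exact ⟨⟨AddCommMonCat.of N, hN, hNtf⟩, AddCommMonCat.ofHom f, hf, hr⟩
  choose next map hmap href using step
  let X (n : ℕ) : {X : AddCommMonCat.{u} // IsConical X ∧ PTorsionFree P X} :=
    Nat.rec ⟨AddCommMonCat.of M, hM, hMtf⟩ (fun _ Y => next Y) n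
  let g (n : ℕ) : (X n).1 ⟶ (X (n + 1)).1 := map (X n)
  have hg (n : ℕ) : (Functor.ofSequence g).map (homOfLE n.le_succ) = g n :=
    Functor.ofSequence_map_homOfLE_succ g n
  refine ⟨Functor.ofSequence g, rfl, fun i => (X i).2.1, fun i => (X i).2.2, fun i j h => ?_,
    fun i => ?_⟩
  · induction j, h using Nat.le_induction with
    | base =>
      have : homOfLE (le_refl i) = 𝟙 i := rfl
      rw [this, CategoryTheory.Functor.map_id]
      exact IsStronglyUnitary.id
    | succ j h ih =>
      have : homOfLE (h.trans j.le_succ) = homOfLE h ≫ homOfLE j.le_succ := rfl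
      rw [this, Functor.map_comp, hg]
      exact (hmap (X j)).comp ih
  · rw [hg]
    exact href (X i)

variable {G : ℕ → Type u} [∀ i, AddCommMonoid (G i)] {f : ∀ i j, i ≤ j → G i →+ G j}
  [DirectedSystem G (f · · ·)]

/-- The canonical map from the first term of a sequence of monoids to its direct limit. -/
noncomputable def DirectLimit.ofZero : G 0 →+ DirectLimit G f where
  toFun x := ⟦⟨0, x⟩⟧
  map_zero' := (DirectLimit.zero_def 0).symm
  map_add' x y := (DirectLimit.add_def 0 x y).symm

theorem DirectLimit.ofZero_eq (i : ℕ) (x : G 0) :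
    DirectLimit.ofZero x = (⟦⟨i, f 0 i i.zero_le x⟩⟧ : DirectLimit G f) :=
  DirectLimit.eq_of_le ⟨0, x⟩ i i.zero_le

theorem DirectLimit.isStronglyUnitary_ofZero (hf : ∀ i j h, IsStronglyUnitary (f i j h)) :
    IsStronglyUnitary (DirectLimit.ofZero : G 0 →+ DirectLimit G f) := by
  have inj (i : ℕ) : Function.Injective fun x => (⟦⟨i, x⟩⟧ : DirectLimit G f) :=
    DirectLimit.mk_injective f (fun i j h => (hf i j h).injective) i
  refine ⟨⟨inj 0, fun b => ?_, fun a₀ a₁ b e => ?_⟩, fun m hm b ⟨a, e⟩ => ?_⟩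
  · obtain ⟨i, b, rfl⟩ := DirectLimit.exists_eq_mk f b
    obtain ⟨a, z, hz⟩ := (hf 0 i i.zero_le).1.2.1 b
    exact ⟨a, ⟦⟨i, z⟩⟧, by rw [DirectLimit.add_def, hz, DirectLimit.ofZero_eq i]⟩
  · obtain ⟨i, b, rfl⟩ := DirectLimit.exists_eq_mk f b
    rw [DirectLimit.ofZero_eq i, DirectLimit.ofZero_eq i, DirectLimit.add_def] at e
    obtain ⟨a, rfl⟩ := (hf 0 i i.zero_le).1.2.2 _ _ _ (inj i e)
    exact ⟨a, DirectLimit.ofZero_eq i a⟩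
  · obtain ⟨i, b, rfl⟩ := DirectLimit.exists_eq_mk f b
    rw [DirectLimit.ofZero_eq i, DirectLimit.nsmul_def] at e
    obtain ⟨a, rfl⟩ := (hf 0 i i.zero_le).2 m hm b ⟨a, inj i e⟩
    exact ⟨a, DirectLimit.ofZero_eq i a⟩

theorem DirectLimit.isConical (hf : ∀ i j h, Function.Injective (f i j h))
    (hG : ∀ i, IsConical (G i)) : IsConical (DirectLimit G f) := by
  intro x y
  obtain ⟨i, x, y, rfl, rfl⟩ := DirectLimit.exists_eq_mk₂ f x y
  rw [DirectLimit.add_def, DirectLimit.zero_def i]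
  intro e
  obtain ⟨rfl, rfl⟩ := hG i x y (DirectLimit.mk_injective f hf i e)
  exact ⟨rfl, rfl⟩

theorem DirectLimit.pTorsionFree {P : Set ℕ} (hf : ∀ i j h, Function.Injective (f i j h))
    (hG : ∀ i, PTorsionFree P (G i)) : PTorsionFree P (DirectLimit G f) := by
  intro p hp x y
  obtain ⟨i, x, y, rfl, rfl⟩ := DirectLimit.exists_eq_mk₂ f x y
  rw [DirectLimit.nsmul_def, DirectLimit.nsmul_def]
  intro e
  rw [hG i p hp x y (DirectLimit.mk_injective f hf i e)]

theorem DirectLimit.isRefinementMonoid (hf : ∀ i j h, Function.Injective (f i j h))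
    (hG : ∀ i, ∀ a₀ a₁ b₀ b₁ : G i, a₀ + a₁ = b₀ + b₁ → ∃ c₀₀ c₀₁ c₁₀ c₁₁ : G (i + 1),
      f i _ i.le_succ a₀ = c₀₀ + c₀₁ ∧ f i _ i.le_succ a₁ = c₁₀ + c₁₁ ∧
      f i _ i.le_succ b₀ = c₀₀ + c₁₀ ∧ f i _ i.le_succ b₁ = c₀₁ + c₁₁) :
    IsRefinementMonoid (DirectLimit G f) := by
  intro a₀ a₁ b₀ b₁
  obtain ⟨i, a₀, a₁, rfl, rfl⟩ := DirectLimit.exists_eq_mk₂ f a₀ a₁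
  obtain ⟨j, b₀, b₁, rfl, rfl⟩ := DirectLimit.exists_eq_mk₂ f b₀ b₁
  obtain ⟨k, hik, hjk⟩ := exists_ge_ge i j
  rw [← DirectLimit.mk_apply i k a₀ hik, ← DirectLimit.mk_apply i k a₁ hik,
    ← DirectLimit.mk_apply j k b₀ hjk, ← DirectLimit.mk_apply j k b₁ hjk,
    DirectLimit.add_def, DirectLimit.add_def]
  intro e
  obtain ⟨c₀₀, c₀₁, c₁₀, c₁₁, h₁, h₂, h₃, h₄⟩ :=
    hG k _ _ _ _ (DirectLimit.mk_injective f hf k e)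
  refine ⟨⟦⟨k + 1, c₀₀⟩⟧, ⟦⟨k + 1, c₀₁⟩⟧, ⟦⟨k + 1, c₁₀⟩⟧, ⟦⟨k + 1, c₁₁⟩⟧, ?_, ?_, ?_, ?_⟩ <;>
    rw [DirectLimit.add_def, ← DirectLimit.mk_apply k (k + 1) _ k.le_succ]
  · rw [h₁]
  · rw [h₂]
  · rw [h₃]
  · rw [h₄]

end Limit

/-- Every `ℙ`-torsion-free cone admits a strongly unitary embedding into a
`ℙ`-torsion-free refinement cone. -/
theorem PTorsionFree_cone_stronglyUnitary_embeds
    (P : Set ℕ) (hPpos : ∀ p ∈ P, 0 < p) (hPmul : ∀ p ∈ P, ∀ q ∈ P, p * q ∈ P)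
    (M : Type u) [AddCommMonoid M] (hM : IsConical M) (hMtf : PTorsionFree P M) :
    ∃ (N : Type u) (_ : AddCommMonoid N),
      IsConical N ∧ PTorsionFree P N ∧ IsRefinementMonoid N ∧
      ∃ f : M →+ N, IsStronglyUnitary f := by
  obtain ⟨F, h₀, hcon, htf, hsu, href⟩ := exists_refining_functor hPpos M hM hMtf
  let f (i j : ℕ) (h : i ≤ j) : F.obj i →+ F.obj j := (F.map (CategoryTheory.homOfLE h)).hom
  have : DirectedSystem (fun i => F.obj i) (f · · ·) :=
    { map_self := fun i x => congrArg (fun φ : (F.obj i).Hom (F.obj i) => φ.hom x) (F.map_id i)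
      map_map := fun k j i hij hjk x => congrArg (fun φ : (F.obj i).Hom (F.obj k) => φ.hom x)
        (F.map_comp (CategoryTheory.homOfLE hij) (CategoryTheory.homOfLE hjk)).symm }
  have hinj : ∀ i j h, Function.Injective (f i j h) := fun i j h => (hsu i j h).injective
  let e : M →+ F.obj 0 := (CategoryTheory.eqToHom h₀.symm).hom
  have he : IsStronglyUnitary e := by
    have key : ∀ (X : AddCommMonCat.{u}) (h : AddCommMonCat.of M = X),
        IsStronglyUnitary (CategoryTheory.eqToHom h).hom := by
      rintro _ rfl
      exact IsStronglyUnitary.id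
    exact key _ h₀.symm
  exact ⟨DirectLimit (fun i => F.obj i) f, inferInstance, DirectLimit.isConical hinj hcon,
    DirectLimit.pTorsionFree hinj htf, DirectLimit.isRefinementMonoid hinj href,
    DirectLimit.ofZero.comp e, (DirectLimit.isStronglyUnitary_ofZero hsu).comp he⟩
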